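/- Under the sensitivity model, assume λ(g(X)) is integrable. Then for every bounded measurable function h : E → ℝ, E[ (Y(1) − f(X) − ρ·σ·λ(g(X))) · T · h(X) ] = 0. In other words, the conditional mean of the potential outcome among the treated is m(X) = E(Y(1) | X, T = 1) = f(X) + ρ·σ·λ(g(X)) almost surely on {T = 1}. -/

import Mathlib

open MeasureTheory ProbabilityTheory Real

/-- The standard normal density φ(x) = (2π)^{-1/2} exp(-x²/2). -/
noncomputable def stdNormalPDF (x : ℝ) : ℝ :=
  (Real.sqrt (2 * Real.pi))⁻¹ * Real.exp (-x ^ 2 / 2)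

/-- The standard normal distribution function Φ(x) = ∫_{-∞}^x φ(t) dt. -/
noncomputable def stdNormalCDF (x : ℝ) : ℝ :=
  ∫ t in Set.Iic x, stdNormalPDF t

/-- The inverse Mills ratio λ(x) = φ(x)/Φ(x). -/
noncomputable def invMills (x : ℝ) : ℝ :=
  stdNormalPDF x / stdNormalCDF x

lemma stdNormalPDF_eq_gaussianPDFReal : stdNormalPDF = gaussianPDFReal 0 1 := by
  ext x
  simp [stdNormalPDF, gaussianPDFReal]

lemma stdNormalPDF_pos (x : ℝ) : 0 < stdNormalPDF x := by
  unfold stdNormalPDF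
  positivity

lemma integrable_stdNormalPDF : Integrable stdNormalPDF := by
  rw [stdNormalPDF_eq_gaussianPDFReal]
  exact integrable_gaussianPDFReal 0 1

lemma measurable_stdNormalPDF : Measurable stdNormalPDF := by
  unfold stdNormalPDF
  fun_prop

lemma stdNormalCDF_pos (x : ℝ) : 0 < stdNormalCDF x := by
  unfold stdNormalCDF
  rw [setIntegral_pos_iff_support_of_nonneg_ae
    (Filter.Eventually.of_forall fun t => (stdNormalPDF_pos t).le)
    integrable_stdNormalPDF.integrableOn]
  have : Function.support stdNormalPDF = Set.univ := by
    ext t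
    simp [(stdNormalPDF_pos t).ne']
  simp [this]

lemma monotone_stdNormalCDF : Monotone stdNormalCDF := fun _ _ hab =>
  setIntegral_mono_set integrable_stdNormalPDF.integrableOn
    (Filter.Eventually.of_forall fun t => (stdNormalPDF_pos t).le)
    (Set.Iic_subset_Iic.2 hab).eventuallyLE

lemma measurable_invMills : Measurable invMills :=
  measurable_stdNormalPDF.div monotone_stdNormalCDF.measurable

lemma stdNormalPDF_neg (x : ℝ) : stdNormalPDF (-x) = stdNormalPDF x := by
  simp [stdNormalPDF]

/-- Symmetry of the normal law: the upper tail above `-a` has mass `Φ(a)`. -/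
lemma setIntegral_Ioi_neg_stdNormalPDF (a : ℝ) :
    ∫ z in Set.Ioi (-a), stdNormalPDF z = stdNormalCDF a := by
  rw [← integral_comp_neg_Iic]
  simp only [stdNormalPDF_neg, stdNormalCDF]

lemma integrable_mul_stdNormalPDF : Integrable fun z => z * stdNormalPDF z := by
  have h := (integrable_mul_exp_neg_mul_sq (b := 1 / 2) (by norm_num)).const_mul
    (Real.sqrt (2 * Real.pi))⁻¹
  refine h.congr (Filter.Eventually.of_forall fun z => ?_)
  simp only [stdNormalPDF]
  rw [show -(1 / 2) * z ^ 2 = -z ^ 2 / 2 by ring]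
  ring

lemma hasDerivAt_neg_stdNormalPDF (z : ℝ) :
    HasDerivAt (fun z => -stdNormalPDF z) (z * stdNormalPDF z) z := by
  unfold stdNormalPDF
  have h : HasDerivAt (fun z : ℝ => -z ^ 2 / 2) (-z) z := by
    convert! ((hasDerivAt_pow 2 z).neg.div_const 2) using 1
    ring
  convert! (h.exp.const_mul (Real.sqrt (2 * Real.pi))⁻¹).neg using 1
  ring

lemma tendsto_stdNormalPDF_atTop :
    Filter.Tendsto stdNormalPDF Filter.atTop (nhds 0) := by
  have h : Filter.Tendsto (fun z : ℝ => -z ^ 2 / 2) Filter.atTop Filter.atBot := by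
    have := (Filter.tendsto_pow_atTop (α := ℝ) two_ne_zero).atTop_div_const
      (two_pos : (0 : ℝ) < 2)
    simp only [neg_div]
    exact Filter.tendsto_neg_atTop_atBot.comp this
  rw [← mul_zero (Real.sqrt (2 * Real.pi))⁻¹]
  exact (Real.tendsto_exp_atBot.comp h).const_mul _

/-- The partial first moment of the normal law above `a` is `φ(a)`. -/
lemma setIntegral_Ioi_mul_stdNormalPDF (a : ℝ) :
    ∫ z in Set.Ioi a, z * stdNormalPDF z = stdNormalPDF a := by
  have h := integral_Ioi_of_hasDerivAt_of_tendsto' (a := a)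
    (fun z _ => hasDerivAt_neg_stdNormalPDF z)
    integrable_mul_stdNormalPDF.integrableOn tendsto_stdNormalPDF_atTop.neg
  simpa using h

/-- A standard normal variable truncated to `(-a, ∞)` has mean `λ(a)`. -/
lemma integral_sub_invMills_gaussianReal (a : ℝ) :
    ∫ z, (z - invMills a) * (if 0 < a + z then 1 else 0) ∂(gaussianReal 0 1) = 0 := by
  rw [integral_gaussianReal_eq_integral_smul one_ne_zero, ← stdNormalPDF_eq_gaussianPDFReal]
  have h : ∀ z, stdNormalPDF z • ((z - invMills a) * (if 0 < a + z then (1 : ℝ) else 0)) =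
      (Set.Ioi (-a)).indicator
        (fun z => z * stdNormalPDF z - invMills a * stdNormalPDF z) z := by
    intro z
    by_cases hz : 0 < a + z
    · rw [Set.indicator_of_mem (by simp only [Set.mem_Ioi]; linarith)]
      simp only [hz, if_true, smul_eq_mul]
      ring
    · rw [Set.indicator_of_notMem (by simp only [Set.mem_Ioi]; linarith)]
      simp [hz]
  simp_rw [h]
  rw [integral_indicator measurableSet_Ioi,
    integral_sub integrable_mul_stdNormalPDF.integrableOn
      (integrable_stdNormalPDF.const_mul _).integrableOn,
    integral_const_mul, setIntegral_Ioi_mul_stdNormalPDF, setIntegral_Ioi_neg_stdNormalPDF,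
    stdNormalPDF_neg, invMills, div_mul_cancel₀ _ (stdNormalCDF_pos a).ne', sub_self]

/-- Under the sensitivity model, if `λ(g(X))` is integrable then for every
bounded measurable `h : E → ℝ`,
`E[(Y(1) − f(X) − ρ·σ·λ(g(X))) · T · h(X)] = 0`;
i.e. `E(Y(1) | X, T = 1) = f(X) + ρ·σ·λ(g(X))` a.s. on `{T = 1}`. -/
theorem conditional_mean_treated
    {Ω : Type*} [MeasurableSpace Ω] {P : Measure Ω} [IsProbabilityMeasure P]
    {E : Type*} [MeasurableSpace E]
    (X : Ω → E) (hX : Measurable X)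
    (η : Ω → ℝ) (hη : Measurable η)
    (hlaw : Measure.map η P = gaussianReal 0 1)
    (hindep : IndepFun η X P)
    (ε : Ω → ℝ) (hε : Measurable ε)
    (hεInt : Integrable ε P) (hεMean : ∫ ω, ε ω ∂P = 0)
    (hεIndep : IndepFun ε (fun ω => (X ω, η ω)) P)
    (ρ σ : ℝ) (hσ : 0 ≤ σ)
    (f g : E → ℝ) (hf : Measurable f) (hg : Measurable g)
    (hfInt : Integrable (fun ω => f (X ω)) P)
    (ξ : Ω → ℝ) (hξ : ∀ ω, ξ ω = ρ * σ * η ω + ε ω)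
    (Y1 : Ω → ℝ) (hY1 : ∀ ω, Y1 ω = f (X ω) + ξ ω)
    (T : Ω → ℝ) (hT : ∀ ω, T ω = if 0 < g (X ω) + η ω then 1 else 0)
    (hMills : Integrable (fun ω => invMills (g (X ω))) P)
    (h : E → ℝ) (hh : Measurable h) (C : ℝ) (hbd : ∀ e, |h e| ≤ C) :
    ∫ ω, (Y1 ω - f (X ω) - ρ * σ * invMills (g (X ω))) * T ω * h (X ω) ∂P = 0 := by
  let D : E × ℝ → ℝ := fun p => (if 0 < g p.1 + p.2 then 1 else 0) * h p.1
  have hD : Measurable D :=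
    (Measurable.ite (measurableSet_lt measurable_const (by fun_prop)) measurable_const
      measurable_const).mul (by fun_prop)
  have hDbd : ∀ p, ‖D p‖ ≤ C := by
    intro p
    have hC := hbd p.1
    simp only [D, Real.norm_eq_abs]
    split_ifs
    · simpa using hC
    · simpa using (abs_nonneg _).trans hC
  let G : E × ℝ → ℝ := fun p => (p.2 - invMills (g p.1)) * D p
  have hG : Measurable G :=
    (measurable_snd.sub (measurable_invMills.comp (hg.comp measurable_fst))).mul hD
  have hXη : Measurable fun ω => (X ω, η ω) := hX.prodMk hη
  have hDXη : AEStronglyMeasurable (fun ω => D (X ω, η ω)) P :=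
    (hD.comp hXη).aestronglyMeasurable
  have hηInt : Integrable η P := by
    have : Integrable id (Measure.map η P) := by
      rw [hlaw]
      exact (memLp_id_gaussianReal 1).integrable le_rfl
    exact this.comp_measurable hη
  have hGInt : Integrable (fun ω => G (X ω, η ω)) P :=
    (hηInt.sub hMills).mul_bdd (c := C) hDXη (Filter.Eventually.of_forall fun _ => hDbd _)
  have hεDInt : Integrable (fun ω => ε ω * D (X ω, η ω)) P :=
    hεInt.mul_bdd (c := C) hDXη (Filter.Eventually.of_forall fun _ => hDbd _)
  have hmap := hindep.symm.map_prod_eq_prod_map_map hX.aemeasurable hη.aemeasurable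
  rw [hlaw] at hmap
  have hεD : ∫ ω, ε ω * D (X ω, η ω) ∂P = 0 := by
    have hind : IndepFun ε (fun ω => D (X ω, η ω)) P := hεIndep.comp measurable_id hD
    rw [hind.integral_fun_mul_eq_mul_integral hε.aestronglyMeasurable hDXη, hεMean, zero_mul]
  have hGzero : ∫ ω, G (X ω, η ω) ∂P = 0 := by
    have : IsProbabilityMeasure (P.map X) := Measure.isProbabilityMeasure_map hX.aemeasurable
    have hGInt' : Integrable G ((P.map X).prod (gaussianReal 0 1)) := by
      rw [← hmap]
      exact (integrable_map_measure hG.aestronglyMeasurable hXη.aemeasurable).2 hGInt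
    rw [← integral_map hXη.aemeasurable hG.aestronglyMeasurable, hmap, integral_prod _ hGInt']
    simp only [G, D, ← mul_assoc, integral_mul_const, integral_sub_invMills_gaussianReal,
      zero_mul, integral_zero]
  have hsplit : ∀ ω, (Y1 ω - f (X ω) - ρ * σ * invMills (g (X ω))) * T ω * h (X ω) =
      ρ * σ * G (X ω, η ω) + ε ω * D (X ω, η ω) := by
    intro ω
    rw [hY1, hξ, hT]
    simp only [G, D]
    ring
  simp_rw [hsplit]
  rw [integral_add (hGInt.const_mul _) hεDInt, integral_const_mul, hGzero, hεD, mul_zero, add_zero]
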